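/- If C is a singly-even self-dual binary code of length 56 with minimum distance 12, then there exists a doubly-even self-dual binary code C' of length 56 with minimum distance 12 that is a neighbor of C, i.e., dim(C ∩ C') = 27. -/

import Mathlib

open Finset

/-- Hamming weight of a binary vector. -/
def wt {n : ℕ} (a : Fin n → ZMod 2) : ℕ :=
  (Finset.univ.filter fun i => a i ≠ 0).card

/-- Number of coordinates where both vectors are 1. -/
def mu {n : ℕ} (a b : Fin n → ZMod 2) : ℕ :=
  (Finset.univ.filter fun i => a i = 1 ∧ b i = 1).card

/-- The dual code with respect to the standard inner product over F_2. -/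
def dualCode {n : ℕ} (C : Submodule (ZMod 2) (Fin n → ZMod 2)) :
    Submodule (ZMod 2) (Fin n → ZMod 2) where
  carrier := {x | ∀ c ∈ C, ∑ i, x i * c i = 0}
  zero_mem' := by intro c hc; simp
  add_mem' := by
    intro x y hx hy c hc
    simp [add_mul, Finset.sum_add_distrib, hx c hc, hy c hc]
  smul_mem' := by
    intro r x hx c hc
    simp [mul_assoc, ← Finset.mul_sum, hx c hc]

def IsSelfDual {n : ℕ} (C : Submodule (ZMod 2) (Fin n → ZMod 2)) : Prop :=
  C = dualCode C

def DoublyEven {n : ℕ} (C : Submodule (ZMod 2) (Fin n → ZMod 2)) : Prop :=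
  ∀ c ∈ C, 4 ∣ wt c

def SinglyEven {n : ℕ} (C : Submodule (ZMod 2) (Fin n → ZMod 2)) : Prop :=
  ∃ c ∈ C, ¬ 4 ∣ wt c

/-- Minimum distance: smallest nonzero weight of a codeword. -/
noncomputable def minDist {n : ℕ} (C : Submodule (ZMod 2) (Fin n → ZMod 2)) : ℕ :=
  sInf {d | ∃ c ∈ C, c ≠ 0 ∧ wt c = d}

/-! ### Weights, intersections and inner products -/

theorem ZMod.eq_one_of_ne_zero_two {a : ZMod 2} (h : a ≠ 0) : a = 1 := by
  revert h; revert a; decide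

theorem wt_eq_card_filter_eq_one {n : ℕ} (x : Fin n → ZMod 2) : wt x = #{i | x i = 1} := by
  unfold wt
  congr 1
  ext i
  simp only [mem_filter, mem_univ, true_and]
  generalize x i = a
  revert a; decide

theorem wt_add {n : ℕ} (x y : Fin n → ZMod 2) : wt (x + y) + 2 * mu x y = wt x + wt y := by
  unfold wt mu
  simp only [card_filter, mul_sum, ← sum_add_distrib, Pi.add_apply]
  refine sum_congr rfl fun i _ => ?_
  generalize x i = a
  generalize y i = b
  revert a b; decide

theorem cast_mu {n : ℕ} (x y : Fin n → ZMod 2) : (mu x y : ZMod 2) = ∑ i, x i * y i := by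
  unfold mu
  simp only [card_filter, Nat.cast_sum]
  refine sum_congr rfl fun i _ => ?_
  generalize x i = a
  generalize y i = b
  revert a b; decide

theorem wt_pos {n : ℕ} {x : Fin n → ZMod 2} (hx : x ≠ 0) : 0 < wt x := by
  obtain ⟨i, hi⟩ := Function.ne_iff.mp hx
  exact card_pos.mpr ⟨i, by simpa using hi⟩

theorem wt_zero (n : ℕ) : wt (0 : Fin n → ZMod 2) = 0 := by
  simp [wt]

theorem wt_one (n : ℕ) : wt (1 : Fin n → ZMod 2) = n := by
  simp [wt]

theorem mu_one_right {n : ℕ} (x : Fin n → ZMod 2) : mu x 1 = wt x := by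
  simp [mu, wt_eq_card_filter_eq_one]

theorem wt_le {n : ℕ} (x : Fin n → ZMod 2) : wt x ≤ n := by
  simpa [wt] using card_filter_le (univ : Finset (Fin n)) (fun i => x i ≠ 0)

theorem eq_one_of_wt_eq {n : ℕ} {x : Fin n → ZMod 2} (hx : wt x = n) : x = 1 := by
  funext i
  have h : #{i | x i ≠ 0} = #(univ : Finset (Fin n)) := by simpa [wt] using hx
  exact ZMod.eq_one_of_ne_zero_two (card_filter_eq_iff.mp h i (mem_univ i))

theorem add_self_eq_zero_vec {n : ℕ} (x : Fin n → ZMod 2) : x + x = 0 := by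
  funext i
  exact CharTwo.add_self_eq_zero (x i)

/-! ### Duality -/

/-- The standard bilinear form on `F_2^n`. -/
noncomputable def stdForm (n : ℕ) : LinearMap.BilinForm (ZMod 2) (Fin n → ZMod 2) :=
  Matrix.toBilin' 1

theorem stdForm_apply {n : ℕ} (x y : Fin n → ZMod 2) : stdForm n x y = ∑ i, x i * y i := by
  simp [stdForm, Matrix.toBilin'_apply', dotProduct]

theorem stdForm_nondegenerate (n : ℕ) : (stdForm n).Nondegenerate :=
  Matrix.Nondegenerate.toBilin' (Matrix.nondegenerate_of_det_ne_zero (by simp))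

theorem stdForm_isRefl (n : ℕ) : (stdForm n).IsRefl := by
  intro x y h
  rw [stdForm_apply] at h ⊢
  simpa only [mul_comm] using h

theorem mem_dualCode {n : ℕ} {C : Submodule (ZMod 2) (Fin n → ZMod 2)} {x : Fin n → ZMod 2} :
    x ∈ dualCode C ↔ ∀ c ∈ C, ∑ i, x i * c i = 0 :=
  Iff.rfl

theorem dualCode_eq_orthogonal {n : ℕ} (C : Submodule (ZMod 2) (Fin n → ZMod 2)) :
    dualCode C = (stdForm n).orthogonal C := by
  ext x
  simp only [mem_dualCode, LinearMap.BilinForm.mem_orthogonal_iff,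
    stdForm_apply, mul_comm]

theorem finrank_dualCode {n : ℕ} (C : Submodule (ZMod 2) (Fin n → ZMod 2)) :
    Module.finrank (ZMod 2) (dualCode C) = n - Module.finrank (ZMod 2) C := by
  rw [dualCode_eq_orthogonal, LinearMap.BilinForm.finrank_orthogonal (stdForm_nondegenerate n)]
  simp

theorem dualCode_dualCode {n : ℕ} (C : Submodule (ZMod 2) (Fin n → ZMod 2)) :
    dualCode (dualCode C) = C := by
  rw [dualCode_eq_orthogonal, dualCode_eq_orthogonal,
    LinearMap.BilinForm.orthogonal_orthogonal (stdForm_nondegenerate n) (stdForm_isRefl n)]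

/-- The codewords of `C` as a finset. -/
noncomputable def words {n : ℕ} (C : Submodule (ZMod 2) (Fin n → ZMod 2)) :
    Finset (Fin n → ZMod 2) :=
  (C : Set (Fin n → ZMod 2)).toFinite.toFinset

theorem mem_words {n : ℕ} {C : Submodule (ZMod 2) (Fin n → ZMod 2)} {x : Fin n → ZMod 2} :
    x ∈ words C ↔ x ∈ C := by
  simp [words]

theorem card_words {n : ℕ} (C : Submodule (ZMod 2) (Fin n → ZMod 2)) :
    #(words C) = 2 ^ Module.finrank (ZMod 2) C := by
  have h := Module.natCard_eq_pow_finrank (K := ZMod 2) (V := C)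
  rw [Nat.card_zmod] at h
  rw [← h, words, ← Set.ncard_eq_toFinset_card, ← Nat.card_coe_set_eq]
  rfl

/-! ### Characters -/

/-- The nontrivial additive character of `F_2`. -/
def chi (a : ZMod 2) : ℤ := if a = 0 then 1 else -1

theorem chi_add (a b : ZMod 2) : chi (a + b) = chi a * chi b := by
  revert a b; decide

theorem chi_sum {ι : Type*} (s : Finset ι) (f : ι → ZMod 2) :
    chi (∑ i ∈ s, f i) = ∏ i ∈ s, chi (f i) := by
  classical
  induction s using Finset.induction_on with
  | empty => simp [chi]
  | insert a s ha ih => rw [sum_insert ha, prod_insert ha, chi_add, ih]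

theorem sum_chi_words_of_mem {n : ℕ} {D : Submodule (ZMod 2) (Fin n → ZMod 2)}
    {x : Fin n → ZMod 2} (hx : x ∈ dualCode D) :
    ∑ c ∈ words D, chi (∑ i, x i * c i) = #(words D) := by
  rw [sum_congr rfl fun c hc => by rw [hx c (mem_words.mp hc)]]
  simp [chi]

theorem sum_chi_words_of_notMem {n : ℕ} {D : Submodule (ZMod 2) (Fin n → ZMod 2)}
    {x : Fin n → ZMod 2} (hx : x ∉ dualCode D) :
    ∑ c ∈ words D, chi (∑ i, x i * c i) = 0 := by
  rw [mem_dualCode] at hx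
  push Not at hx
  obtain ⟨d, hd, hxd⟩ := hx
  have h : ∑ c ∈ words D, chi (∑ i, x i * c i) = ∑ c ∈ words D, -chi (∑ i, x i * c i) := by
    refine sum_bij' (fun c _ => c + d) (fun c _ => c + d) ?_ ?_ ?_ ?_ ?_
    · exact fun c hc => mem_words.mpr (D.add_mem (mem_words.mp hc) hd)
    · exact fun c hc => mem_words.mpr (D.add_mem (mem_words.mp hc) hd)
    · intro c _
      simp [add_assoc, add_self_eq_zero_vec]
    · intro c _
      simp [add_assoc, add_self_eq_zero_vec]
    · intro c _
      simp only [Pi.add_apply, mul_add, sum_add_distrib, chi_add,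
        ZMod.eq_one_of_ne_zero_two hxd]
      simp [chi]
  rw [sum_neg_distrib] at h
  omega

/-! ### Orthogonal arrays -/

/-- A set of binary vectors is an orthogonal array of strength `t` if, on any at most `t`
coordinates, the all-ones pattern appears with the frequency expected of random vectors. -/
def HasStrength {n : ℕ} (S : Finset (Fin n → ZMod 2)) (t : ℕ) : Prop :=
  ∀ T : Finset (Fin n), #T ≤ t → #{s ∈ S | ∀ i ∈ T, s i = 1} * 2 ^ #T = #S

theorem hasStrength_words {n t : ℕ} {D : Submodule (ZMod 2) (Fin n → ZMod 2)}
    (hD : ∀ x ∈ dualCode D, x ≠ 0 → t < wt x) : HasStrength (words D) t := by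
  classical
  intro T hT
  have hprod : ∀ c : Fin n → ZMod 2, ∏ i ∈ T, (-chi (c i) + 1) =
      if ∀ i ∈ T, c i = 1 then (2 : ℤ) ^ #T else 0 := by
    intro c
    split_ifs with h
    · rw [prod_congr rfl fun i hi => by rw [h i hi], prod_const]
      simp [chi]
    · push Not at h
      obtain ⟨i, hi, hci⟩ := h
      refine prod_eq_zero hi ?_
      generalize c i = a at hci
      revert a; decide
  have hexp : ∀ c : Fin n → ZMod 2, ∏ i ∈ T, (-chi (c i) + 1) =
      ∑ U ∈ T.powerset, (-1) ^ #U * chi (∑ i, (if i ∈ U then 1 else 0) * c i) := by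
    intro c
    rw [prod_add]
    refine sum_congr rfl fun U _ => ?_
    simp [prod_neg, chi_sum]
  have key : ∑ c ∈ words D, ∏ i ∈ T, (-chi (c i) + 1) = #(words D) := by
    simp only [hexp]
    rw [sum_comm, sum_eq_single_of_mem ∅ (empty_mem_powerset T)]
    · simp [chi]
    · intro U hU hne
      rw [← mul_sum, sum_chi_words_of_notMem, mul_zero]
      intro hmem
      have hwt : wt (fun i => if i ∈ U then (1 : ZMod 2) else 0) = #U := by simp [wt]
      have hU' := card_le_card (mem_powerset.mp hU)
      obtain ⟨j, hj⟩ := nonempty_iff_ne_empty.mpr hne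
      have := hD _ hmem fun h0 => by simpa [hj] using congrFun h0 j
      omega
  simp only [hprod, ← sum_filter, sum_const, nsmul_eq_mul] at key
  exact_mod_cast key

theorem HasStrength.sdiff {n t : ℕ} {S S' : Finset (Fin n → ZMod 2)} (hS : HasStrength S t)
    (hS' : HasStrength S' t) (h : S' ⊆ S) : HasStrength (S \ S') t := by
  intro T hT
  have hsub : {s ∈ S' | ∀ i ∈ T, s i = 1} ⊆ {s ∈ S | ∀ i ∈ T, s i = 1} := filter_subset_filter _ h
  have hfil : {s ∈ S \ S' | ∀ i ∈ T, s i = 1} =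
      {s ∈ S | ∀ i ∈ T, s i = 1} \ {s ∈ S' | ∀ i ∈ T, s i = 1} := by
    ext s
    simp only [mem_filter, mem_sdiff]
    tauto
  rw [hfil, card_sdiff_of_subset hsub, card_sdiff_of_subset h, Nat.sub_mul, hS T hT, hS' T hT]

theorem HasStrength.sum_choose {n t : ℕ} {S : Finset (Fin n → ZMod 2)} (hS : HasStrength S t)
    (p : Fin n) {k : ℕ} (hk : k + 1 ≤ t) :
    (∑ s ∈ S with s p = 1, (wt s - 1).choose k) * 2 ^ (k + 1) = (n - 1).choose k * #S := by
  have hchoose : ∀ s ∈ S.filter (fun s => s p = 1), (wt s - 1).choose k =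
      #{T ∈ powersetCard k (univ.erase p) | ∀ i ∈ T, s i = 1} := by
    intro s hs
    have hp : s p = 1 := (mem_filter.mp hs).2
    rw [wt_eq_card_filter_eq_one, ← card_erase_of_mem (a := p) (by simpa using hp),
      ← card_powersetCard]
    congr 1
    ext T
    simp only [mem_powersetCard, mem_filter, subset_iff, mem_erase, mem_univ, and_true, true_and]
    grind
  rw [sum_congr rfl hchoose]
  simp only [card_filter _ (powersetCard k (univ.erase p))]
  rw [sum_comm, sum_mul]
  have hcount : ∀ T ∈ powersetCard k (univ.erase p),
      (∑ s ∈ S with s p = 1, if ∀ i ∈ T, s i = 1 then 1 else 0) * 2 ^ (k + 1) = #S := by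
    intro T hT
    obtain ⟨hTp, hTk⟩ := mem_powersetCard.mp hT
    have hpT : p ∉ T := fun h => by simpa using hTp h
    have hcard : #(insert p T) = k + 1 := by rw [card_insert_of_notMem hpT, hTk]
    rw [← hS (insert p T) (by omega), hcard, ← card_filter, filter_filter]
    simp
  rw [sum_congr rfl hcount, sum_const, card_powersetCard, card_erase_of_mem (mem_univ p)]
  simp

/-- Evaluation of a polynomial in the weight, given in the binomial basis, over the members of an
orthogonal array with a `1` at a given coordinate. -/
theorem HasStrength.sum_sum_choose {n t m : ℕ} {S : Finset (Fin n → ZMod 2)}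
    (hS : HasStrength S t) (p : Fin n) (hm : m ≤ t) (a : ℕ → ℤ) :
    (∑ s ∈ S with s p = 1, ∑ k ∈ range m, a k * (wt s - 1).choose k) * 2 ^ m =
      ∑ k ∈ range m, a k * (n - 1).choose k * 2 ^ (m - 1 - k) * #S := by
  rw [sum_comm, sum_mul]
  refine sum_congr rfl fun k hk => ?_
  have hkm := mem_range.mp hk
  have h := hS.sum_choose p (k := k) (by omega)
  have hpow : (2 : ℤ) ^ m = 2 ^ (k + 1) * 2 ^ (m - 1 - k) := by
    rw [← pow_add]
    congr 1
    omega
  rw [← mul_sum, hpow]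
  zify at h
  linear_combination (a k * 2 ^ (m - 1 - k)) * h

/-! ### A Gauss sum -/

theorem sum_I_pow_wt_mul_chi {n : ℕ} (c : Fin n → ZMod 2) :
    ∑ x : Fin n → ZMod 2, Complex.I ^ wt x * (chi (∑ i, x i * c i) : ℂ) =
      (1 + Complex.I) ^ n * (-Complex.I) ^ wt c := by
  have hterm : ∀ x : Fin n → ZMod 2, Complex.I ^ wt x * (chi (∑ i, x i * c i) : ℂ) =
      ∏ i, (if x i ≠ 0 then Complex.I else 1) * (chi (x i * c i) : ℂ) := by
    intro x
    rw [chi_sum, prod_mul_distrib, prod_ite, prod_const, prod_const_one, mul_one, wt]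
    push_cast
    rfl
  have hfactor : ∀ i, ∑ a : ZMod 2, (if a ≠ 0 then Complex.I else 1) * (chi (a * c i) : ℂ) =
      (1 + Complex.I) * if c i ≠ 0 then -Complex.I else 1 := by
    intro i
    have hsum : ∀ f : ZMod 2 → ℂ, ∑ a, f a = f 0 + f 1 := Fin.sum_univ_two
    rw [hsum]
    by_cases h : c i = 0
    · simp [h, chi]
    · simp [h, chi, add_mul, ← sub_eq_add_neg]
  simp only [hterm]
  rw [← Fintype.piFinset_univ, ← prod_univ_sum (fun _ => univ)
    fun i a => (if a ≠ 0 then Complex.I else 1) * (chi (a * c i) : ℂ)]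
  simp only [hfactor]
  rw [prod_mul_distrib, prod_const, prod_ite, prod_const, prod_const_one, mul_one, wt]
  simp

theorem sum_I_pow_wt_dualCode {n : ℕ} {D : Submodule (ZMod 2) (Fin n → ZMod 2)}
    (hD : DoublyEven D) :
    ∑ x ∈ words (dualCode D), Complex.I ^ wt x = (1 + Complex.I) ^ n := by
  have hne : (#(words D) : ℂ) ≠ 0 := by
    rw [card_words]
    simp
  refine mul_left_cancel₀ hne ?_
  calc (#(words D) : ℂ) * ∑ x ∈ words (dualCode D), Complex.I ^ wt x
      = ∑ x, Complex.I ^ wt x * ∑ c ∈ words D, (chi (∑ i, x i * c i) : ℂ) := by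
        rw [mul_sum]
        refine sum_subset_zero_on_sdiff (subset_univ _) (fun x hx => ?_) fun x hx => ?_
        · have h := sum_chi_words_of_notMem fun h => (mem_sdiff.mp hx).2 (mem_words.mpr h)
          rw [← Int.cast_sum, h, Int.cast_zero, mul_zero]
        · rw [← Int.cast_sum, sum_chi_words_of_mem (mem_words.mp hx), mul_comm]
          rfl
    _ = ∑ c ∈ words D, ∑ x, Complex.I ^ wt x * (chi (∑ i, x i * c i) : ℂ) := by
        simp only [mul_sum]
        exact sum_comm
    _ = ∑ c ∈ words D, (1 + Complex.I) ^ n := by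
        refine sum_congr rfl fun c hc => ?_
        obtain ⟨k, hk⟩ := hD c (mem_words.mp hc)
        rw [sum_I_pow_wt_mul_chi, hk, pow_mul, neg_pow, Complex.I_pow_four]
        norm_num
    _ = #(words D) * (1 + Complex.I) ^ n := by
        rw [sum_const, nsmul_eq_mul]

/-! ### Self-dual codes and their shadows -/

theorem two_dvd_mu_iff {n : ℕ} {x y : Fin n → ZMod 2} :
    2 ∣ mu x y ↔ ∑ i, x i * y i = 0 := by
  rw [← cast_mu, ZMod.natCast_eq_zero_iff]

theorem mem_dualCode_iff_two_dvd_mu {n : ℕ} {C : Submodule (ZMod 2) (Fin n → ZMod 2)}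
    {x : Fin n → ZMod 2} : x ∈ dualCode C ↔ ∀ c ∈ C, 2 ∣ mu x c := by
  simp only [mem_dualCode, two_dvd_mu_iff]

theorem two_dvd_mu_add {n : ℕ} {x y z : Fin n → ZMod 2} :
    2 ∣ mu (x + y) z ↔ (2 ∣ mu x z ↔ 2 ∣ mu y z) := by
  simp only [← ZMod.natCast_eq_zero_iff, cast_mu, Pi.add_apply, add_mul, sum_add_distrib]
  generalize ∑ i, x i * z i = a
  generalize ∑ i, y i * z i = b
  revert a b; decide

theorem mu_comm {n : ℕ} (x y : Fin n → ZMod 2) : mu x y = mu y x := by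
  simp only [mu, and_comm]

theorem mu_self {n : ℕ} (x : Fin n → ZMod 2) : mu x x = wt x := by
  simp [mu, wt_eq_card_filter_eq_one]

theorem mem_sup_span_singleton_iff {n : ℕ} {A : Submodule (ZMod 2) (Fin n → ZMod 2)}
    {v x : Fin n → ZMod 2} : x ∈ A ⊔ Submodule.span (ZMod 2) {v} ↔ x ∈ A ∨ x + v ∈ A := by
  have hcancel : ∀ y : Fin n → ZMod 2, y + v + v = y := fun y => by
    rw [add_assoc, add_self_eq_zero_vec, add_zero]
  simp only [Submodule.mem_sup, Submodule.mem_span_singleton]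
  constructor
  · rintro ⟨y, hy, _, ⟨a, rfl⟩, rfl⟩
    by_cases ha : a = 0
    · left
      simpa [ha] using hy
    · right
      rw [ZMod.eq_one_of_ne_zero_two ha, one_smul, hcancel]
      exact hy
  · rintro (h | h)
    · exact ⟨x, h, 0, ⟨0, by simp⟩, by simp⟩
    · exact ⟨x + v, h, v, ⟨1, by simp⟩, hcancel x⟩

theorem minDist_le {n : ℕ} {C : Submodule (ZMod 2) (Fin n → ZMod 2)} {c : Fin n → ZMod 2}
    (hc : c ∈ C) (h0 : c ≠ 0) : minDist C ≤ wt c :=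
  Nat.sInf_le ⟨c, hc, h0, rfl⟩

theorem DoublyEven.le_dualCode {n : ℕ} {C : Submodule (ZMod 2) (Fin n → ZMod 2)}
    (hC : DoublyEven C) : C ≤ dualCode C := by
  intro x hx
  rw [mem_dualCode_iff_two_dvd_mu]
  intro y hy
  have h := wt_add x y
  have hx4 := hC x hx
  have hy4 := hC y hy
  have hxy4 := hC _ (C.add_mem hx hy)
  omega

namespace IsSelfDual

variable {n : ℕ} {C : Submodule (ZMod 2) (Fin n → ZMod 2)}

theorem mem_iff (hC : IsSelfDual C) {x : Fin n → ZMod 2} : x ∈ C ↔ ∀ c ∈ C, 2 ∣ mu x c := by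
  rw [← mem_dualCode_iff_two_dvd_mu]
  exact SetLike.ext_iff.mp hC x

theorem two_dvd_wt (hC : IsSelfDual C) {x : Fin n → ZMod 2} (hx : x ∈ C) : 2 ∣ wt x := by
  rw [← mu_self]
  exact hC.mem_iff.mp hx x hx

theorem one_mem (hC : IsSelfDual C) : (1 : Fin n → ZMod 2) ∈ C := by
  rw [hC.mem_iff]
  intro c hc
  rw [mu_comm, mu_one_right]
  exact hC.two_dvd_wt hc

theorem two_mul_finrank (hC : IsSelfDual C) : 2 * Module.finrank (ZMod 2) C = n := by
  have h := finrank_dualCode C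
  have hle := Submodule.finrank_le C
  rw [Module.finrank_fin_fun] at hle
  rw [← (hC : C = dualCode C)] at h
  omega

/-- The subcode of words whose weight is divisible by four. -/
def doublyEvenSubcode (hC : IsSelfDual C) : Submodule (ZMod 2) (Fin n → ZMod 2) where
  carrier := {c | c ∈ C ∧ 4 ∣ wt c}
  zero_mem' := ⟨C.zero_mem, by simp [wt]⟩
  add_mem' := by
    rintro x y ⟨hx, hx4⟩ ⟨hy, hy4⟩
    have h := wt_add x y
    have h2 := hC.mem_iff.mp hx y hy
    exact ⟨C.add_mem hx hy, by omega⟩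
  smul_mem' := by
    rintro a x ⟨hx, hx4⟩
    by_cases ha : a = 0
    · simp [ha, wt]
    · rw [ZMod.eq_one_of_ne_zero_two ha, one_smul]
      exact ⟨hx, hx4⟩

theorem mem_doublyEvenSubcode (hC : IsSelfDual C) {x : Fin n → ZMod 2} :
    x ∈ hC.doublyEvenSubcode ↔ x ∈ C ∧ 4 ∣ wt x :=
  Iff.rfl

theorem add_mem_doublyEvenSubcode (hC : IsSelfDual C) {x y : Fin n → ZMod 2} (hx : x ∈ C)
    (hy : y ∈ C) (hx4 : ¬ 4 ∣ wt x) (hy4 : ¬ 4 ∣ wt y) : x + y ∈ hC.doublyEvenSubcode := by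
  have h := wt_add x y
  have h2 := hC.mem_iff.mp hx y hy
  have hx2 := hC.two_dvd_wt hx
  have hy2 := hC.two_dvd_wt hy
  exact ⟨C.add_mem hx hy, by omega⟩

theorem finrank_doublyEvenSubcode (hC : IsSelfDual C) (hse : SinglyEven C) :
    Module.finrank (ZMod 2) C = Module.finrank (ZMod 2) hC.doublyEvenSubcode + 1 := by
  obtain ⟨c, hc, hc4⟩ := hse
  have hnot : c ∉ hC.doublyEvenSubcode := fun h => hc4 h.2
  suffices hsup : C = hC.doublyEvenSubcode ⊔ Submodule.span (ZMod 2) {c} by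
    rw [← Submodule.finrank_sup_span_singleton hnot, ← hsup]
  ext x
  rw [mem_sup_span_singleton_iff]
  constructor
  · intro hx
    by_cases hx4 : 4 ∣ wt x
    · exact Or.inl ⟨hx, hx4⟩
    · exact Or.inr (hC.add_mem_doublyEvenSubcode hx hc hx4 hc4)
  · rintro (hx | hx)
    · exact hx.1
    · exact (C.add_mem_iff_left hc).mp hx.1

/-- The shadow of a singly-even self-dual code. -/
noncomputable def shadow (hC : IsSelfDual C) : Finset (Fin n → ZMod 2) :=
  words (dualCode hC.doublyEvenSubcode) \ words C

theorem mem_shadow (hC : IsSelfDual C) {s : Fin n → ZMod 2} :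
    s ∈ hC.shadow ↔ s ∈ dualCode hC.doublyEvenSubcode ∧ s ∉ C := by
  simp [shadow, mem_words]

theorem le_dualCode_doublyEvenSubcode (hC : IsSelfDual C) :
    C ≤ dualCode hC.doublyEvenSubcode := by
  intro x hx
  rw [mem_dualCode_iff_two_dvd_mu]
  exact fun c hc => hC.mem_iff.mp hx c hc.1

theorem two_dvd_mu_shadow_iff (hC : IsSelfDual C) {s c : Fin n → ZMod 2} (hs : s ∈ hC.shadow)
    (hc : c ∈ C) : 2 ∣ mu s c ↔ 4 ∣ wt c := by
  rw [mem_shadow, mem_dualCode_iff_two_dvd_mu] at hs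
  refine ⟨fun h => ?_, fun h => hs.1 c ⟨hc, h⟩⟩
  by_contra hc4
  refine hs.2 (hC.mem_iff.mpr fun d hd => ?_)
  by_cases hd4 : 4 ∣ wt d
  · exact hs.1 d ⟨hd, hd4⟩
  · have hdc := hs.1 _ (hC.add_mem_doublyEvenSubcode hd hc hd4 hc4)
    rw [mu_comm, two_dvd_mu_add, mu_comm d, mu_comm c] at hdc
    exact hdc.mpr h

theorem shadow_add_mem (hC : IsSelfDual C) {s c : Fin n → ZMod 2} (hs : s ∈ hC.shadow)
    (hc : c ∈ C) : s + c ∈ hC.shadow := by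
  rw [mem_shadow] at hs ⊢
  exact ⟨add_mem hs.1 (hC.le_dualCode_doublyEvenSubcode hc),
    fun h => hs.2 ((C.add_mem_iff_left hc).mp h)⟩

theorem add_mem_of_mem_shadow (hC : IsSelfDual C) {s s' : Fin n → ZMod 2} (hs : s ∈ hC.shadow)
    (hs' : s' ∈ hC.shadow) : s + s' ∈ C := by
  rw [hC.mem_iff]
  intro c hc
  rw [two_dvd_mu_add, hC.two_dvd_mu_shadow_iff hs hc, hC.two_dvd_mu_shadow_iff hs' hc]

theorem four_dvd_wt_add_iff (hC : IsSelfDual C) {s c : Fin n → ZMod 2} (hs : s ∈ hC.shadow)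
    (hc : c ∈ C) : 4 ∣ wt (s + c) ↔ 4 ∣ wt s := by
  have h := wt_add s c
  have h2 := hC.two_dvd_mu_shadow_iff hs hc
  have hc2 := hC.two_dvd_wt hc
  omega

end IsSelfDual

theorem sum_mu_eq_of_card_eq {n r : ℕ} {N : Finset (Fin n → ZMod 2)}
    (hN : ∀ p, #{w ∈ N | w p = 1} = r) (c : Fin n → ZMod 2) : ∑ w ∈ N, mu w c = r * wt c := by
  have hmu : ∀ w : Fin n → ZMod 2, mu w c = ∑ p with c p = 1, if w p = 1 then 1 else 0 := by
    intro w
    rw [mu, ← card_filter, filter_filter]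
    simp only [and_comm]
  simp only [hmu]
  rw [sum_comm]
  simp only [← card_filter, hN, sum_const, smul_eq_mul, wt_eq_card_filter_eq_one]
  ring

/-! ### Length 56 -/

/-- Coefficients in the basis `(w - 1).choose k` of a polynomial in `w` vanishing at
`12, 16, …, 48` and equal to `2 ^ 28` at `8`. -/
def weightEightCoeff (k : ℕ) : ℤ :=
  [11745370923, -4130467627, 1328178566, -385713724, 99593648, -22401192, 4268176, -661504,
    78208, -6272, 256].getD k 0

/-- Coefficients in the basis `(w - 1).choose k` of a polynomial in `w` vanishing at
`16, 20, …, 40` and equal to `31457280` at `56`. -/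
def weightFiftySixCoeff (k : ℕ) : ℤ :=
  [-23774985, 6038409, -1344148, 255018, -39600, 4720, -384, 16].getD k 0

namespace IsSelfDual

variable {C : Submodule (ZMod 2) (Fin 56 → ZMod 2)}

theorem finrank_eq (hC : IsSelfDual C) : Module.finrank (ZMod 2) C = 28 := by
  have h := hC.two_mul_finrank
  omega

theorem finrank_doublyEvenSubcode_eq (hC : IsSelfDual C) (hse : SinglyEven C) :
    Module.finrank (ZMod 2) hC.doublyEvenSubcode = 27 := by
  have h := hC.finrank_doublyEvenSubcode hse
  rw [hC.finrank_eq] at h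
  omega

theorem finrank_dualCode_doublyEvenSubcode (hC : IsSelfDual C) (hse : SinglyEven C) :
    Module.finrank (ZMod 2) (dualCode hC.doublyEvenSubcode) = 29 := by
  rw [finrank_dualCode, hC.finrank_doublyEvenSubcode_eq hse]

theorem words_subset (hC : IsSelfDual C) : words C ⊆ words (dualCode hC.doublyEvenSubcode) :=
  fun _ hx => mem_words.mpr (hC.le_dualCode_doublyEvenSubcode (mem_words.mp hx))

theorem card_shadow (hC : IsSelfDual C) (hse : SinglyEven C) : #hC.shadow = 2 ^ 28 := by
  rw [shadow, card_sdiff_of_subset hC.words_subset, card_words, card_words, hC.finrank_eq,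
    hC.finrank_dualCode_doublyEvenSubcode hse]
  norm_num

theorem four_dvd_wt_shadow (hC : IsSelfDual C) (hse : SinglyEven C) {s : Fin 56 → ZMod 2}
    (hs : s ∈ hC.shadow) : 4 ∣ wt s := by
  by_contra hs4
  have hs2 : 2 ∣ wt s := by
    rw [← mu_one_right, hC.two_dvd_mu_shadow_iff hs hC.one_mem, wt_one]
    norm_num
  have hpow : ∀ x ∈ words (dualCode hC.doublyEvenSubcode), Complex.I ^ wt x =
      (if x ∈ words hC.doublyEvenSubcode then 2 else 0) - 1 := by
    intro x hx
    rw [mem_words] at hx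
    have hI : ∀ m : ℕ, 2 ∣ m → ¬ 4 ∣ m → Complex.I ^ m = -1 := by
      intro m h2 h4
      obtain ⟨k, rfl⟩ : ∃ k, m = 4 * k + 2 := ⟨m / 4, by omega⟩
      rw [pow_add, pow_mul, Complex.I_pow_four, one_pow, one_mul, Complex.I_sq]
    split_ifs with hx0
    · obtain ⟨k, hk⟩ := (mem_words.mp hx0).2
      rw [hk, pow_mul, Complex.I_pow_four]
      norm_num
    · rw [mem_words, mem_doublyEvenSubcode] at hx0
      rw [zero_sub]
      by_cases hxC : x ∈ C
      · exact hI _ (hC.two_dvd_wt hxC) fun h => hx0 ⟨hxC, h⟩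
      · have hxs : x ∈ hC.shadow := hC.mem_shadow.mpr ⟨hx, hxC⟩
        refine hI _ ?_ ?_
        · rw [← mu_one_right, hC.two_dvd_mu_shadow_iff hxs hC.one_mem, wt_one]
          norm_num
        · rwa [← hC.four_dvd_wt_add_iff hxs (hC.add_mem_of_mem_shadow hxs hs), ← add_assoc,
            add_self_eq_zero_vec, zero_add]
  have hsum := sum_I_pow_wt_dualCode (D := hC.doublyEvenSubcode) fun c hc => hc.2
  have hsub : words hC.doublyEvenSubcode ⊆ words (dualCode hC.doublyEvenSubcode) := fun x hx =>
    hC.words_subset (mem_words.mpr (mem_words.mp hx).1)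
  have hval : (1 + Complex.I) ^ 56 = 2 ^ 28 := by
    have hsq : (1 + Complex.I) ^ 2 = 2 * Complex.I := by
      linear_combination Complex.I_sq
    rw [show 56 = 2 * 28 from rfl, pow_mul, hsq, mul_pow, show 28 = 4 * 7 from rfl,
      pow_mul Complex.I, Complex.I_pow_four]
    norm_num
  rw [sum_congr rfl hpow, sum_sub_distrib, ← sum_filter, filter_mem_eq_inter,
    inter_eq_right.mpr hsub, sum_const, sum_const, card_words, card_words,
    hC.finrank_doublyEvenSubcode_eq hse, hC.finrank_dualCode_doublyEvenSubcode hse, hval] at hsum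
  norm_num at hsum

theorem hasStrength_shadow (hC : IsSelfDual C) (hmin : ∀ c ∈ C, c ≠ 0 → 12 ≤ wt c) :
    HasStrength hC.shadow 11 := by
  refine HasStrength.sdiff (hasStrength_words ?_) (hasStrength_words ?_) hC.words_subset
  · rw [dualCode_dualCode]
    exact fun x hx h0 => hmin x hx.1 h0
  · rw [← (hC : C = dualCode C)]
    exact hmin

/-- If the shadow has no words of weight four, then its words of weight eight form a `1`-design. -/
theorem card_shadow_weight_eight (hC : IsSelfDual C) (hse : SinglyEven C)
    (hmin : ∀ c ∈ C, c ≠ 0 → 12 ≤ wt c) (h8 : ∀ s ∈ hC.shadow, 8 ≤ wt s) (p : Fin 56) :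
    #{w ∈ {s ∈ hC.shadow | wt s = 8} | w p = 1} = 11 := by
  have hsum := (hC.hasStrength_shadow hmin).sum_sum_choose p (m := 11) le_rfl weightEightCoeff
  have heval : ∀ s ∈ hC.shadow.filter (fun s => s p = 1), ∑ k ∈ range 11,
      weightEightCoeff k * (wt s - 1).choose k = if wt s = 8 then 2 ^ 28 else 0 := by
    intro s hs
    replace hs := (mem_filter.mp hs).1
    have hlow := h8 s hs
    have hcompl := h8 _ (hC.shadow_add_mem hs hC.one_mem)
    have hadd := wt_add s 1
    rw [mu_one_right, wt_one] at hadd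
    obtain ⟨j, hj⟩ := hC.four_dvd_wt_shadow hse hs
    have hj2 : 2 ≤ j := by omega
    have hj12 : j ≤ 12 := by omega
    rw [hj]
    interval_cases j <;> simp [weightEightCoeff, sum_range_succ, Nat.choose]
  rw [sum_congr rfl heval, ← sum_filter, sum_const, hC.card_shadow hse] at hsum
  rw [filter_filter] at hsum ⊢
  simp only [and_comm] at hsum ⊢
  norm_num [weightEightCoeff, sum_range_succ, Nat.choose] at hsum
  omega

theorem exists_mem_shadow_wt_eq_four (hC : IsSelfDual C) (hse : SinglyEven C)
    (hmin : ∀ c ∈ C, c ≠ 0 → 12 ≤ wt c) : ∃ s ∈ hC.shadow, wt s = 4 := by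
  by_contra! hno
  have h8 : ∀ s ∈ hC.shadow, 8 ≤ wt s := by
    intro s hs
    have h4 := hC.four_dvd_wt_shadow hse hs
    have hne := hno s hs
    have hpos : 0 < wt s := wt_pos fun h => (hC.mem_shadow.mp hs).2 (h ▸ C.zero_mem)
    omega
  have hdesign := sum_mu_eq_of_card_eq (hC.card_shadow_weight_eight hse hmin h8)
  obtain ⟨c, hc, hc4⟩ := hse
  have hcard : #{s ∈ hC.shadow | wt s = 8} * 8 = 11 * 56 := by
    have hone := hdesign 1
    rw [wt_one, sum_congr rfl fun w hw => (mu_one_right w).trans (mem_filter.mp hw).2] at hone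
    simpa using hone
  have hodd : Odd (∑ w ∈ hC.shadow with wt w = 8, mu w c) := by
    have hall : ∀ w ∈ hC.shadow.filter (fun w => wt w = 8), Odd (mu w c) := by
      intro w hw
      rw [← Nat.not_even_iff_odd, even_iff_two_dvd,
        hC.two_dvd_mu_shadow_iff (mem_filter.mp hw).1 hc]
      exact hc4
    rw [odd_sum_iff_odd_card_odd, filter_true_of_mem hall]
    exact ⟨38, by omega⟩
  rw [hdesign c, Nat.odd_mul] at hodd
  have hc2 := hC.two_dvd_wt hc
  have := hodd.2
  grind

theorem exists_wt_eq_twelve (hC : IsSelfDual C) (hde : DoublyEven C)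
    (hmin : ∀ c ∈ C, c ≠ 0 → 12 ≤ wt c) : ∃ c ∈ C, wt c = 12 := by
  by_contra! hno
  have hstrength : HasStrength (words C) 11 := by
    refine hasStrength_words ?_
    rw [← (hC : C = dualCode C)]
    exact hmin
  have hsum := hstrength.sum_sum_choose 0 (m := 8) (by norm_num) weightFiftySixCoeff
  have heval : ∀ c ∈ (words C).filter (fun c => c 0 = 1), ∑ k ∈ range 8,
      weightFiftySixCoeff k * (wt c - 1).choose k = if wt c = 56 then 31457280 else 0 := by
    intro c hc
    rw [mem_filter, mem_words] at hc
    obtain ⟨hc, hc0⟩ := hc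
    have hlow := hmin c hc fun h => by simp [h] at hc0
    have hne := hno c hc
    have hle := wt_le c
    have hadd := wt_add c 1
    rw [mu_one_right, wt_one] at hadd
    have hcompl : wt c ≠ 56 → 12 ≤ wt (c + 1) := fun h =>
      hmin _ (C.add_mem hc hC.one_mem) fun h0 => by
        rw [h0, wt_zero] at hadd
        omega
    have hne' := hno _ (C.add_mem hc hC.one_mem)
    obtain ⟨j, hj⟩ := hde c hc
    obtain rfl | hj14 := eq_or_ne j 14
    · rw [hj]
      simp [weightFiftySixCoeff, sum_range_succ, Nat.choose]
    · have hj4 : 4 ≤ j := by omega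
      have hj10 : j ≤ 10 := by omega
      rw [hj]
      interval_cases j <;> simp [weightFiftySixCoeff, sum_range_succ, Nat.choose]
  have hcard : #{c ∈ {c ∈ words C | c 0 = 1} | wt c = 56} ≤ 1 := by
    rw [card_le_one]
    intro x hx y hy
    rw [eq_one_of_wt_eq (mem_filter.mp hx).2, eq_one_of_wt_eq (mem_filter.mp hy).2]
  rw [sum_congr rfl heval, ← sum_filter, sum_const, card_words, hC.finrank_eq] at hsum
  norm_num [weightFiftySixCoeff, sum_range_succ, Nat.choose] at hsum
  omega

end IsSelfDual

theorem typeI_56_12_has_typeII_neighbor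
    (C : Submodule (ZMod 2) (Fin 56 → ZMod 2))
    (hsd : IsSelfDual C) (hse : SinglyEven C) (hd : minDist C = 12) :
    ∃ C' : Submodule (ZMod 2) (Fin 56 → ZMod 2),
      IsSelfDual C' ∧ DoublyEven C' ∧ minDist C' = 12 ∧
      Module.finrank (ZMod 2) ↥(C ⊓ C') = 27 := by
  have hmin : ∀ c ∈ C, c ≠ 0 → 12 ≤ wt c := fun c hc h0 => hd ▸ minDist_le hc h0
  obtain ⟨w, hw, hw4⟩ := hsd.exists_mem_shadow_wt_eq_four hse hmin
  obtain ⟨c, hc, hc4⟩ := id hse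
  have hs : w + c ∈ hsd.shadow := hsd.shadow_add_mem hw hc
  have hs0 : w + c ∉ hsd.doublyEvenSubcode := fun h => (hsd.mem_shadow.mp hs).2 h.1
  set C' := hsd.doublyEvenSubcode ⊔ Submodule.span (ZMod 2) {w + c} with hC'
  have hmem : ∀ x, x ∈ C' ↔ x ∈ hsd.doublyEvenSubcode ∨ x + (w + c) ∈ hsd.doublyEvenSubcode :=
    fun x => mem_sup_span_singleton_iff
  have hshadow : ∀ x, x + (w + c) ∈ hsd.doublyEvenSubcode → x ∈ hsd.shadow := by
    intro x hx
    have h := hsd.shadow_add_mem hs hx.1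
    rwa [add_comm x, ← add_assoc, add_self_eq_zero_vec, zero_add] at h
  have hde : DoublyEven C' := by
    intro x hx
    rcases (hmem x).mp hx with h | h
    · exact h.2
    · exact hsd.four_dvd_wt_shadow hse (hshadow x h)
  have hrank : Module.finrank (ZMod 2) C' = 28 := by
    rw [hC', Submodule.finrank_sup_span_singleton hs0, hsd.finrank_doublyEvenSubcode_eq hse]
  have hsd' : IsSelfDual C' :=
    Submodule.eq_of_le_of_finrank_eq hde.le_dualCode (by rw [finrank_dualCode, hrank])
  have hmin' : ∀ x ∈ C', x ≠ 0 → 12 ≤ wt x := by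
    intro x hx h0
    rcases (hmem x).mp hx with h | h
    · exact hmin x h.1 h0
    · have hxw : x + w ∈ C := hsd.add_mem_of_mem_shadow (hshadow x h) hw
      have hxw4 : ¬ 4 ∣ wt (x + w) := by
        intro h4
        have hcmem := hsd.doublyEvenSubcode.add_mem h ⟨hxw, h4⟩
        rw [show x + (w + c) + (x + w) = (x + w) + (x + w) + c by abel, add_self_eq_zero_vec,
          zero_add] at hcmem
        exact hc4 hcmem.2
      have hxw12 := hmin _ hxw fun h0 => hxw4 (by simp [h0, wt_zero])
      have hxw2 := hsd.two_dvd_wt hxw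
      have hadd := wt_add x w
      have hx4 := hde x hx
      omega
  obtain ⟨d, hdC, hd12⟩ := hsd'.exists_wt_eq_twelve hde hmin'
  have hd0 : d ≠ 0 := fun h => by simp [h, wt_zero] at hd12
  refine ⟨C', hsd', hde, ?_, ?_⟩
  · refine le_antisymm (hd12 ▸ minDist_le hdC hd0) ?_
    refine le_csInf ⟨12, d, hdC, hd0, hd12⟩ ?_
    rintro _ ⟨x, hx, hx0, rfl⟩
    exact hmin' x hx hx0
  · have hinf : C ⊓ C' = hsd.doublyEvenSubcode := by
      ext x
      rw [Submodule.mem_inf, hmem]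
      constructor
      · rintro ⟨hxC, h | h⟩
        · exact h
        · exact absurd hxC (hsd.mem_shadow.mp (hshadow x h)).2
      · exact fun h => ⟨h.1, Or.inl h⟩
    rw [hinf, hsd.finrank_doublyEvenSubcode_eq hse]
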